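/- Under the setup below, with G(y) = g(x(y))·x'(y) and ϖ_k = G^{(k)}(0)/k!, for every integer i with 1 ≤ i ≤ n+2 and every y with |y| ≤ min(r_1, r_2, Δ M) one has G^{(i)}(y) = Σ_{k=0}^{2n−i} ((k+i)!/k!) ϖ_{k+i} y^k + O( U |y|^{2n+1−i} ( 1/M^{2n+1} + 1/N^{2n+1} ) ), with implied constant depending only on n and C_0, …, C_{2n+3}. -/

import Mathlib

namespace WSP
open Set

def Bd (s : Set ℝ) (L : ℝ) (k : ℕ) (A : ℝ) (φ : ℝ → ℝ) : Prop :=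
  ContDiffOn ℝ k φ s ∧ ∀ j ≤ k, ∀ x ∈ s, |iteratedDerivWithin j φ s x| ≤ A / L ^ j

variable {s S : Set ℝ} {L A B : ℝ} {k : ℕ} {φ ψ : ℝ → ℝ}

theorem Bd.abs_le (h : Bd s L k A φ) {x : ℝ} (hx : x ∈ s) : |φ x| ≤ A := by
  simpa using h.2 0 (Nat.zero_le _) x hx

theorem Bd_zero : Bd s L 0 A φ ↔ ContinuousOn φ s ∧ ∀ x ∈ s, |φ x| ≤ A := by
  simp [Bd, contDiffOn_zero]

theorem Bd_succ (hs : UniqueDiffOn ℝ s) : Bd s L (k + 1) A φ ↔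
    DifferentiableOn ℝ φ s ∧ (∀ x ∈ s, |φ x| ≤ A) ∧ Bd s L k (A / L) (derivWithin φ s) := by
  constructor
  · intro h
    have h1 := h.1
    push_cast at h1
    rw [contDiffOn_succ_iff_derivWithin hs] at h1
    refine ⟨h1.1, fun x hx => h.abs_le hx, h1.2.2, fun j hj x hx => ?_⟩
    have := h.2 (j + 1) (by omega) x hx
    rw [iteratedDerivWithin_succ'] at this
    rwa [div_div, ← pow_succ']
  · rintro ⟨h1, h2, h3, h4⟩
    refine ⟨?_, ?_⟩
    · push_cast
      rw [contDiffOn_succ_iff_derivWithin hs]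
      exact ⟨h1, fun h => by simp at h, h3⟩
    · intro j hj x hx
      rcases j with _ | j
      · simpa using h2 x hx
      · rw [iteratedDerivWithin_succ', pow_succ', ← div_div]
        exact h4 j (by omega) x hx

theorem Bd.congr (h : Bd s L k A φ) (e : EqOn ψ φ s) : Bd s L k A ψ :=
  ⟨h.1.congr e, fun j hj x hx => by rw [iteratedDerivWithin_congr e hx]; exact h.2 j hj x hx⟩

theorem Bd.mono (hL : 0 < L) (h : Bd s L k A φ) (hAB : A ≤ B) : Bd s L k B φ :=
  ⟨h.1, fun j hj x hx => (h.2 j hj x hx).trans (by gcongr)⟩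

theorem Bd.mono_L {L' : ℝ} (hL : 0 < L') (hA : 0 ≤ A) (h : Bd s L k A φ) (hLL : L' ≤ L) :
    Bd s L' k A φ :=
  ⟨h.1, fun j hj x hx => (h.2 j hj x hx).trans (by gcongr)⟩

theorem Bd.mono_k {l : ℕ} (h : Bd s L k A φ) (hl : l ≤ k) : Bd s L l A φ :=
  ⟨h.1.of_le (by exact_mod_cast hl), fun j hj x hx => h.2 j (hj.trans hl) x hx⟩

theorem Bd.add (hs : UniqueDiffOn ℝ s) (h : Bd s L k A φ) (h' : Bd s L k B ψ) :
    Bd s L k (A + B) (fun x => φ x + ψ x) := by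
  induction k generalizing A B φ ψ with
  | zero =>
    rw [Bd_zero] at *
    exact ⟨h.1.add h'.1, fun x hx => (abs_add_le _ _).trans (add_le_add (h.2 x hx) (h'.2 x hx))⟩
  | succ k ih =>
    rw [Bd_succ hs] at *
    refine ⟨h.1.add h'.1,
      fun x hx => (abs_add_le _ _).trans (add_le_add (h.2.1 x hx) (h'.2.1 x hx)), ?_⟩
    rw [add_div]
    refine (ih h.2.2 h'.2.2).congr fun x hx => ?_
    exact derivWithin_fun_add (h.1 x hx) (h'.1 x hx)

theorem Bd.mul (hs : UniqueDiffOn ℝ s) (hL : 0 < L) (hA : 0 ≤ A) (hB : 0 ≤ B)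
    (h : Bd s L k A φ) (h' : Bd s L k B ψ) :
    Bd s L k (2 ^ k * (A * B)) (fun x => φ x * ψ x) := by
  induction k generalizing A B φ ψ with
  | zero =>
    rw [Bd_zero] at *
    refine ⟨h.1.mul h'.1, fun x hx => ?_⟩
    rw [abs_mul, pow_zero, one_mul]
    exact mul_le_mul (h.2 x hx) (h'.2 x hx) (abs_nonneg _) hA
  | succ k ih =>
    have hk := h.mono_k (Nat.le_succ k)
    have hk' := h'.mono_k (Nat.le_succ k)
    rw [Bd_succ hs] at *
    refine ⟨h.1.mul h'.1, fun x hx => ?_, ?_⟩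
    · rw [abs_mul]
      refine (mul_le_mul (h.2.1 x hx) (h'.2.1 x hx) (abs_nonneg _) hA).trans ?_
      exact le_mul_of_one_le_left (by positivity) (one_le_pow₀ (by norm_num))
    have h1 := (ih (by positivity) hB h.2.2 hk').add hs (ih hA (by positivity) hk h'.2.2)
    have e : 2 ^ k * (A / L * B) + 2 ^ k * (A * (B / L)) = 2 ^ (k + 1) * (A * B) / L := by
      ring
    rw [← e]
    refine h1.congr fun x hx => ?_
    exact derivWithin_fun_mul (h.1 x hx) (h'.1 x hx)

/-- composition constants -/
noncomputable def cc (B : ℝ) : ℕ → ℝ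
  | 0 => 1
  | k + 1 => 1 + 2 ^ k * (cc B k * B)

theorem cc_one_le (hB : 0 ≤ B) (k : ℕ) : 1 ≤ cc B k := by
  induction k with
  | zero => simp [cc]
  | succ k ih => 
    have : 0 ≤ cc B k := by linarith
    have : 0 ≤ 2 ^ k * (cc B k * B) := by positivity
    simp only [cc]; linarith

/-- Composition, first order step included in the hypothesis on the derivative. -/
theorem Bd.comp {M : ℝ} {x : ℝ → ℝ} (hs : UniqueDiffOn ℝ s) (hS : UniqueDiffOn ℝ S)
    (hL : 0 < L) (hM : 0 < M) (hA : 0 ≤ A) (hB : 0 ≤ B) (h : Bd S M k A φ) (hx : MapsTo x s S)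
    (hc : ContinuousOn x s)
    (hd : ∀ j, k = j + 1 → DifferentiableOn ℝ x s ∧ Bd s L j (B * M / L) (derivWithin x s)) :
    Bd s L k (cc B k * A) (fun y => φ (x y)) := by
  induction k generalizing A φ with
  | zero =>
    rw [Bd_zero] at *
    refine ⟨h.1.comp hc hx, fun y hy => ?_⟩
    simpa [cc] using h.2 _ (hx hy)
  | succ k ih =>
    rw [Bd_succ hS] at h
    obtain ⟨hd1, hd2⟩ := hd k rfl
    have h1 := ih (A := A / M) (by positivity) h.2.2 (by
      rintro j rfl
      exact ⟨hd1, hd2.mono_k (Nat.le_succ _)⟩)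
    have hcc := cc_one_le hB k
    have hcc' := cc_one_le hB (k+1)
    have h2 := h1.mul hs hL (by positivity) (by positivity) hd2
    rw [Bd_succ hs]
    refine ⟨h.1.comp hd1 hx, fun y hy => ?_, ?_⟩
    · exact (h.2.1 _ (hx hy)).trans (le_mul_of_one_le_left hA hcc')
    · refine (h2.mono hL (B := cc B (k+1) * A / L) ?_).congr fun y hy => ?_
      · have : 2 ^ k * (cc B k * (A / M) * (B * M / L)) = (2 ^ k * (cc B k * B)) * A / L := by
          field_simp
        rw [this]
        simp only [cc]
        gcongr
        linarith
      · exact derivWithin_comp y (h.1 _ (hx hy)) (hd1 y hy) hx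

/-- composition where the outer function has scale one. -/
theorem Bd.comp_one {x : ℝ → ℝ} (hs : UniqueDiffOn ℝ s) (hS : UniqueDiffOn ℝ S)
    (hL : 0 < L) (hA : 0 ≤ A) (hB : 0 ≤ B) (h : Bd S 1 k A φ) (hx : MapsTo x s S)
    (hd : Bd s L k B x) :
    Bd s L k (cc B k * A) (fun y => φ (x y)) := by
  refine h.comp hs hS hL one_pos hA hB hx hd.1.continuousOn ?_
  rintro j rfl
  rw [Bd_succ hs] at hd
  exact ⟨hd.1, by simpa using hd.2.2⟩

/-- Smooth functions on compact intervals. -/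
theorem exists_Bd {a b : ℝ} (hab : a < b) (k : ℕ) (h : ContDiffOn ℝ k φ (Icc a b)) :
    ∃ A, 0 < A ∧ Bd (Icc a b) 1 k A φ := by
  have h1 : ∀ j : ℕ, ∃ A, j ≤ k → ∀ x ∈ Icc a b, ‖iteratedDerivWithin j φ (Icc a b) x‖ ≤ A := by
    intro j
    by_cases hj : j ≤ k
    · obtain ⟨A, hA⟩ := isCompact_Icc.exists_bound_of_continuousOn
        (h.continuousOn_iteratedDerivWithin (m := j) (by exact_mod_cast hj) (uniqueDiffOn_Icc hab))
      exact ⟨A, fun _ => hA⟩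
    · exact ⟨0, fun h => absurd h hj⟩
  choose A hA using h1
  refine ⟨∑ j ∈ Finset.range (k + 1), |A j| + 1, by positivity, h, fun j hj x hx => ?_⟩
  have h2 := hA j hj x hx
  have h3 : |A j| ≤ ∑ j ∈ Finset.range (k + 1), |A j| :=
    Finset.single_le_sum (f := fun j => |A j|) (fun _ _ => abs_nonneg _)
      (Finset.mem_range.2 (by omega))
  rw [one_pow, div_one, ← Real.norm_eq_abs]
  linarith [le_abs_self (A j)]

/-- Taylor. -/
theorem taylor_bd {a b E : ℝ} (hab : a < b) (h0 : (0 : ℝ) ∈ Icc a b) (m : ℕ)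
    (h : ContDiffOn ℝ m φ (Icc a b))
    (hE : ∀ x ∈ Icc a b, |iteratedDerivWithin m φ (Icc a b) x| ≤ E) (y : ℝ) (hy : y ∈ Icc a b) :
    |φ y - ∑ k ∈ Finset.range m, iteratedDerivWithin k φ (Icc a b) 0 / (k.factorial : ℝ) * y ^ k|
      ≤ E * |y| ^ m := by
  have hE0 : 0 ≤ E := (abs_nonneg _).trans (hE 0 h0)
  induction m generalizing φ y with
  | zero => simpa using hE y hy
  | succ m ih =>
    push_cast at h
    have hs := uniqueDiffOn_Icc hab
    rw [contDiffOn_succ_iff_derivWithin hs] at h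
    have ih' := ih h.2.2 (by intro x hx; rw [← iteratedDerivWithin_succ']; exact hE x hx)
    have hsub : uIcc 0 y ⊆ Icc a b := uIcc_subset_Icc h0 hy
    have key := Convex.norm_image_sub_le_of_norm_hasDerivWithin_le (s := uIcc 0 y) (x := 0) (y := y)
      (C := E * |y| ^ m)
      (f := fun y => φ y -
        ∑ k ∈ Finset.range (m+1), iteratedDerivWithin k φ (Icc a b) 0 / (k.factorial : ℝ) * y ^ k)
      (f' := fun y => derivWithin φ (Icc a b) y - ∑ k ∈ Finset.range m,
        iteratedDerivWithin k (derivWithin φ (Icc a b)) (Icc a b) 0 / (k.factorial : ℝ) * y ^ k)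
      ?_ ?_ (convex_uIcc _ _) left_mem_uIcc right_mem_uIcc
    · rw [Finset.sum_range_succ'] at key
      simp only [Real.norm_eq_abs] at key
      rw [Finset.sum_range_succ'] at key
      have hz : ∑ k ∈ Finset.range m, iteratedDerivWithin (k + 1) φ (Icc a b) 0 /
          ((k + 1).factorial : ℝ) * (0 : ℝ) ^ (k + 1) = 0 :=
        Finset.sum_eq_zero (by intro i _; simp)
      rw [hz] at key
      rw [Finset.sum_range_succ']
      simp only [pow_zero, iteratedDerivWithin_zero, Nat.factorial_zero, Nat.cast_one, div_one,
        mul_one, zero_add, sub_self, sub_zero] at key ⊢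
      rw [pow_succ, ← mul_assoc]
      exact key
    · intro z hz
      refine HasDerivWithinAt.sub ((h.1 z (hsub hz)).hasDerivWithinAt.mono hsub) ?_
      have : ∀ k ∈ Finset.range (m+1), HasDerivWithinAt
          (fun y : ℝ => iteratedDerivWithin k φ (Icc a b) 0 / (k.factorial : ℝ) * y ^ k)
          (iteratedDerivWithin k φ (Icc a b) 0 / (k.factorial : ℝ) * (k * z ^ (k - 1)))
          (uIcc 0 y) z := fun k _ =>
        ((hasDerivAt_pow k z).const_mul _).hasDerivWithinAt
      have := HasDerivWithinAt.fun_sum this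
      convert this using 1
      rw [Finset.sum_range_succ']
      simp only [Nat.cast_zero, zero_mul, mul_zero, add_zero]
      refine Finset.sum_congr rfl fun k _ => ?_
      rw [iteratedDerivWithin_succ', Nat.factorial_succ]
      push_cast
      field_simp
    · intro z hz
      refine (ih' z (hsub hz)).trans ?_
      have : |z| ≤ |y| := by
        have := abs_sub_left_of_mem_uIcc hz
        simpa using this
      gcongr

theorem exists_ext {a b : ℝ} (hab : a < b) (h : DifferentiableOn ℝ φ (Icc a b))
    (h' : ContinuousOn (derivWithin φ (Icc a b)) (Icc a b)) :
    ∃ W W' : ℝ → ℝ, (∀ x, HasDerivAt W (W' x) x) ∧ Continuous W' ∧ (∃ A, ∀ x, |W' x| ≤ A) ∧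
      EqOn W φ (Icc a b) ∧ EqOn W' (derivWithin φ (Icc a b)) (Icc a b) := by
  set W' : ℝ → ℝ := IccExtend hab.le ((Icc a b).domRestrict (derivWithin φ (Icc a b))) with hW'
  have hc : Continuous W' := Continuous.Icc_extend' (continuousOn_iff_continuous_domRestrict.1 h')
  have he : EqOn W' (derivWithin φ (Icc a b)) (Icc a b) := fun x hx => by
    rw [hW', IccExtend_of_mem _ _ hx]; rfl
  have hd : ∀ x, HasDerivAt (fun x => φ a + ∫ t in a..x, W' t) (W' x) x := fun x =>
    (intervalIntegral.integral_hasDerivAt_right (hc.intervalIntegrable _ _)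
      hc.aestronglyMeasurable.stronglyMeasurableAtFilter hc.continuousAt).const_add _
  refine ⟨fun x => φ a + ∫ t in a..x, W' t, W', hd, hc, ?_, ?_, he⟩
  · obtain ⟨A, hA⟩ := isCompact_Icc.exists_bound_of_continuousOn h'
    refine ⟨A, fun x => ?_⟩
    simp only [hW', IccExtend, Function.comp]
    exact hA _ (projIcc a b hab.le x).2
  · intro x hx
    have hs := uniqueDiffOn_Icc hab
    have := constant_of_derivWithin_zero (a := a) (b := b)
      (f := fun x => (φ a + ∫ t in a..x, W' t) - φ x)
      (fun x hx => ((hd x).differentiableAt.differentiableWithinAt).sub (h x hx)) (by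
        intro x hx
        have hx := Ico_subset_Icc_self hx
        rw [((hd x).hasDerivWithinAt.fun_sub (h x hx).hasDerivWithinAt).derivWithin (hs x hx), he hx,
          sub_self]) x hx
    simp at this
    simp only
    linarith

/-- averaged function. -/
noncomputable def J (γ : ℝ) (m : ℕ) (w : ℝ → ℝ) (x : ℝ) : ℝ :=
  ∫ t in (0 : ℝ)..1, t ^ m * w (γ + t * (x - γ))

theorem seg_mem {a b γ x t : ℝ} (hγ : γ ∈ Icc a b) (hx : x ∈ Icc a b) (ht : t ∈ Icc (0:ℝ) 1) :
    γ + t * (x - γ) ∈ Icc a b := by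
  obtain ⟨h1, h2⟩ := hγ
  obtain ⟨h3, h4⟩ := hx
  obtain ⟨h5, h6⟩ := ht
  constructor <;> nlinarith

theorem J_congr {a b γ : ℝ} {w v : ℝ → ℝ} (hγ : γ ∈ Icc a b) (m : ℕ) (h : EqOn w v (Icc a b)) :
    EqOn (J γ m w) (J γ m v) (Icc a b) := by
  intro x hx
  refine intervalIntegral.integral_congr fun t ht => ?_
  rw [uIcc_of_le zero_le_one] at ht
  rw [h (seg_mem hγ hx ht)]

theorem J_cont {a b γ : ℝ} {w : ℝ → ℝ} (hab : a < b) (hγ : γ ∈ Icc a b) (m : ℕ)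
    (h : ContinuousOn w (Icc a b)) : ContinuousOn (J γ m w) (Icc a b) := by
  have hc : Continuous (IccExtend hab.le ((Icc a b).domRestrict w)) :=
    Continuous.Icc_extend' (continuousOn_iff_continuous_domRestrict.1 h)
  have he : EqOn w (IccExtend hab.le ((Icc a b).domRestrict w)) (Icc a b) := fun x hx => by
    rw [IccExtend_of_mem _ _ hx]; rfl
  refine ContinuousOn.congr (Continuous.continuousOn ?_) (J_congr hγ m he)
  unfold J
  apply intervalIntegral.continuous_parametric_intervalIntegral_of_continuous'
  fun_prop

theorem J_deriv {a b γ : ℝ} {w : ℝ → ℝ} (hab : a < b) (hγ : γ ∈ Icc a b) (m : ℕ)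
    (h : DifferentiableOn ℝ w (Icc a b))
    (h' : ContinuousOn (derivWithin w (Icc a b)) (Icc a b)) {x : ℝ} (hx : x ∈ Icc a b) :
    HasDerivWithinAt (J γ m w) (J γ (m+1) (derivWithin w (Icc a b)) x) (Icc a b) x := by
  obtain ⟨W, W', hd, hc, ⟨A, hA⟩, e, e'⟩ := exists_ext hab h h'
  have hWc : Continuous W := continuous_iff_continuousAt.2 fun x => (hd x).continuousAt
  rw [← J_congr hγ (m+1) e' hx]
  refine HasDerivWithinAt.congr (HasDerivAt.hasDerivWithinAt ?_) (J_congr hγ m e.symm)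
    (J_congr hγ m e.symm hx)
  have := (intervalIntegral.hasDerivAt_integral_of_dominated_loc_of_deriv_le
    (μ := MeasureTheory.volume) (a := 0) (b := 1) (x₀ := x) (s := univ) (bound := fun _ => A)
    (F := fun x t => t ^ m * W (γ + t * (x - γ)))
    (F' := fun x t => t ^ (m+1) * W' (γ + t * (x - γ))) Filter.univ_mem
    (Filter.Eventually.of_forall fun x => Continuous.aestronglyMeasurable (by fun_prop))
    (Continuous.intervalIntegrable (by fun_prop) _ _)
    (Continuous.aestronglyMeasurable (by fun_prop))
    (Filter.Eventually.of_forall fun t ht x _ => ?_)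
    (continuous_const.intervalIntegrable _ _)
    (Filter.Eventually.of_forall fun t ht x _ => ?_)).2
  · exact this
  · rw [uIoc_of_le zero_le_one] at ht
    rw [norm_mul, Real.norm_eq_abs, Real.norm_eq_abs, abs_of_nonneg (pow_nonneg ht.1.le _)]
    calc _ ≤ 1 * |W' (γ + t * (x - γ))| := by
          gcongr
          exact pow_le_one₀ ht.1.le ht.2
      _ ≤ A := by rw [one_mul]; exact hA _
  · have h1 : HasDerivAt (fun x : ℝ => γ + t * (x - γ)) (t * 1) x :=
      (((hasDerivAt_id x).sub_const γ).const_mul t).const_add γ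
    have h2 := ((hd (γ + t * (x - γ))).comp x h1).const_mul (t ^ m)
    exact HasDerivAt.congr_deriv (f := fun x => t ^ m * W (γ + t * (x - γ))) h2 (by ring)

theorem J_Bd {a b γ : ℝ} {w : ℝ → ℝ} (hab : a < b) (hγ : γ ∈ Icc a b) (m : ℕ)
    (h : Bd (Icc a b) L k A w) : Bd (Icc a b) L k A (J γ m w) := by
  have hs := uniqueDiffOn_Icc hab
  have hb : ∀ x ∈ Icc a b, |J γ m w x| ≤ A := by
    intro x hx
    have := intervalIntegral.norm_integral_le_of_norm_le_const (a := 0) (b := 1) (C := A)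
      (f := fun t => t ^ m * w (γ + t * (x - γ))) (by
        intro t ht
        rw [uIoc_of_le zero_le_one] at ht
        rw [norm_mul, Real.norm_eq_abs, Real.norm_eq_abs, abs_of_nonneg (pow_nonneg ht.1.le _)]
        calc _ ≤ 1 * |w (γ + t * (x - γ))| := by
              gcongr
              exact pow_le_one₀ ht.1.le ht.2
          _ ≤ A := by rw [one_mul]; exact h.abs_le (seg_mem hγ hx ⟨ht.1.le, ht.2⟩))
    simpa [J] using this
  induction k generalizing A m w with
  | zero =>
    rw [Bd_zero] at *
    exact ⟨J_cont hab hγ m h.1, hb⟩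
  | succ k ih =>
    rw [Bd_succ hs] at *
    have hd := fun x hx => J_deriv hab hγ m h.1 h.2.2.1.continuousOn (x := x) hx
    refine ⟨fun x hx => (hd x hx).differentiableWithinAt, hb, ?_⟩
    refine (ih (m+1) h.2.2 ?_).congr fun x hx => (hd x hx).derivWithin (hs x hx)
    intro x hx
    have := intervalIntegral.norm_integral_le_of_norm_le_const (a := 0) (b := 1) (C := A / L)
      (f := fun t => t ^ (m+1) * derivWithin w (Icc a b) (γ + t * (x - γ))) (by
        intro t ht
        rw [uIoc_of_le zero_le_one] at ht
        rw [norm_mul, Real.norm_eq_abs, Real.norm_eq_abs, abs_of_nonneg (pow_nonneg ht.1.le _)]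
        calc _ ≤ 1 * |derivWithin w (Icc a b) (γ + t * (x - γ))| := by
              gcongr
              exact pow_le_one₀ ht.1.le ht.2
          _ ≤ A / L := by rw [one_mul]; exact h.2.2.abs_le (seg_mem hγ hx ⟨ht.1.le, ht.2⟩))
    simpa [J] using this

theorem J_ftc {a b γ : ℝ} {w : ℝ → ℝ} (hab : a < b) (hγ : γ ∈ Icc a b)
    (h : DifferentiableOn ℝ w (Icc a b))
    (h' : ContinuousOn (derivWithin w (Icc a b)) (Icc a b)) {x : ℝ} (hx : x ∈ Icc a b) :
    w x - w γ = (x - γ) * J γ 0 (derivWithin w (Icc a b)) x := by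
  obtain ⟨W, W', hd, hc, -, e, e'⟩ := exists_ext hab h h'
  rw [← J_congr hγ 0 e' hx, ← e hx, ← e hγ, J, ← intervalIntegral.integral_const_mul]
  have := intervalIntegral.integral_eq_sub_of_hasDerivAt (a := 0) (b := 1)
    (f := fun t => W (γ + t * (x - γ)))
    (f' := fun t => (x - γ) * (t ^ 0 * W' (γ + t * (x - γ)))) (fun t _ => by
      have h1 : HasDerivAt (fun t : ℝ => γ + t * (x - γ)) (1 * (x - γ)) t :=
        ((hasDerivAt_id t).mul_const (x - γ)).const_add γ
      have h2 := ((hd (γ + t * (x - γ))).comp t h1)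
      exact HasDerivAt.congr_deriv (f := fun t => W (γ + t * (x - γ))) h2 (by ring)) (Continuous.intervalIntegrable (by fun_prop) _ _)
  rw [this]
  simp


theorem Bd.const_mul (hs : UniqueDiffOn ℝ s) (h : Bd s L k A φ) (c : ℝ) :
    Bd s L k (|c| * A) (fun x => c * φ x) := by
  induction k generalizing A φ with
  | zero =>
    rw [Bd_zero] at *
    refine ⟨continuousOn_const.mul h.1, fun x hx => ?_⟩
    rw [abs_mul]
    exact mul_le_mul_of_nonneg_left (h.2 x hx) (abs_nonneg _)
  | succ k ih =>
    rw [Bd_succ hs] at *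
    refine ⟨h.1.const_mul c, fun x hx => ?_, ?_⟩
    · rw [abs_mul]
      exact mul_le_mul_of_nonneg_left (h.2.1 x hx) (abs_nonneg _)
    · rw [mul_div_assoc]
      refine (ih h.2.2).congr fun x hx => ?_
      exact derivWithin_const_mul c (h.1 x hx)

theorem phi_const (k : ℕ) (c A0 : ℝ) (hc : 0 < c) (hA0 : 0 < A0) :
    ∃ A1, 0 < A1 ∧ ∀ (s : Set ℝ) (L : ℝ) (P Z : ℝ → ℝ), UniqueDiffOn ℝ s → 0 < L →
      Bd s L k A0 P → Bd s L k (c * A0) Z → (∀ x ∈ s, P x ∈ Icc (1 / c) (1 / c + c)) →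
      (∀ x ∈ s, Z x ∈ Icc (1 / (4 * c ^ 2)) (1 / (4 * c ^ 2) + c ^ 2)) →
      Bd s L k A1 (fun x => √(Z x) * (2 * (P x)⁻¹)) := by
  have hp1 : 0 < 1 / c := by positivity
  have hp2 : 0 < 1 / (4 * c ^ 2) := by positivity
  have i1 : 1 / c < 1 / c + c := by linarith
  have i2 : 1 / (4 * c ^ 2) < 1 / (4 * c ^ 2) + c ^ 2 := by
    have : 0 < c ^ 2 := by positivity
    linarith
  obtain ⟨B1, hB1, b1⟩ := exists_Bd (φ := fun u => 2 * u⁻¹) i1 k (by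
    intro x hx
    have : x ≠ 0 := (hp1.trans_le hx.1).ne'
    exact (contDiffAt_const.mul (contDiffAt_inv ℝ this)).contDiffWithinAt)
  obtain ⟨B2, hB2, b2⟩ := exists_Bd (φ := fun u => √u) i2 k (by
    intro x hx
    have : x ≠ 0 := (hp2.trans_le hx.1).ne'
    exact (Real.contDiffAt_sqrt this).contDiffWithinAt)
  have hc1 := cc_one_le hA0.le k
  have hc2 := cc_one_le (B := c * A0) (by positivity) k
  refine ⟨2 ^ k * (cc (c * A0) k * B2 * (cc A0 k * B1)), by positivity, ?_⟩
  intro s L P Z hs hL hP hZ mP mZ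
  have t1 := b1.comp_one hs (uniqueDiffOn_Icc i1) hL hB1.le hA0.le mP hP
  have t2 := b2.comp_one hs (uniqueDiffOn_Icc i2) hL hB2.le (by positivity) mZ hZ
  exact t2.mul hs hL (by positivity) (by positivity) t1

theorem inv_deriv {a b c : ℝ} {s : Set ℝ} {h D x : ℝ → ℝ} (hc : 0 < c)
    (hd : ∀ z ∈ Icc a b, HasDerivWithinAt h (D z) (Icc a b) z) (hD : ∀ z ∈ Icc a b, c ≤ D z)
    (hx : MapsTo x s (Icc a b)) (hi : ∀ y ∈ s, h (x y) = y) :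
    ContinuousOn x s ∧ ∀ y ∈ s, HasDerivWithinAt x (D (x y))⁻¹ s y := by
  have hmono : ∀ u ∈ Icc a b, ∀ v ∈ Icc a b, u ≤ v → c * (v - u) ≤ h v - h u := by
    have hda : ∀ z ∈ interior (Icc a b), HasDerivAt h (D z) z := fun z hz =>
      (hd z (interior_subset hz)).hasDerivAt (mem_interior_iff_mem_nhds.1 hz)
    refine (convex_Icc a b).mul_sub_le_image_sub_of_le_deriv
      (fun z hz => (hd z hz).continuousWithinAt)
      (fun z hz => (hda z hz).differentiableAt.differentiableWithinAt) ?_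
    intro z hz
    rw [(hda z hz).deriv]
    exact hD z (interior_subset hz)
  have hlip : ∀ u ∈ s, ∀ v ∈ s, |x u - x v| ≤ c⁻¹ * |u - v| := by
    intro u hu v hv
    rw [inv_mul_eq_div, le_div_iff₀ hc]
    rcases le_total (x u) (x v) with h1 | h1
    · have := hmono _ (hx hu) _ (hx hv) h1
      rw [hi u hu, hi v hv] at this
      rw [abs_sub_comm, abs_of_nonneg (by linarith), abs_sub_comm]
      linarith [le_abs_self (v - u)]
    · have := hmono _ (hx hv) _ (hx hu) h1
      rw [hi u hu, hi v hv] at this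
      rw [abs_of_nonneg (by linarith)]
      linarith [le_abs_self (u - v)]
  have hcont : ContinuousOn x s := by
    have : LipschitzOnWith (Real.toNNReal c⁻¹) x s := by
      refine LipschitzOnWith.of_dist_le_mul fun u hu v hv => ?_
      rw [Real.dist_eq, Real.dist_eq, Real.coe_toNNReal _ (by positivity)]
      exact hlip u hu v hv
    exact this.continuousOn
  refine ⟨hcont, fun y hy => ?_⟩
  have hne : D (x y) ≠ 0 := (hc.trans_le (hD _ (hx hy))).ne'
  have := HasFDerivWithinAt.of_local_left_inverse (g := x) (f := h)
    (f' := ContinuousLinearEquiv.unitsEquivAut ℝ (Units.mk0 _ hne)) (a := y) (s := s)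
    (t := Icc a b)
    ((hcont y hy).tendsto_nhdsWithin hx)
    ((hd _ (hx hy)).hasFDerivWithinAt.congr_fderiv (by ext; simp)) hy
    (by filter_upwards [self_mem_nhdsWithin] with z hz using hi z hz)
  have := this.hasDerivWithinAt
  simpa using this

noncomputable def bb (A1 : ℝ) : ℕ → ℝ
  | 0 => A1
  | j + 1 => cc (bb A1 j) (j + 1) * A1

theorem bb_pos {A1 : ℝ} (h : 0 < A1) (j : ℕ) : 0 < bb A1 j := by
  induction j with
  | zero => exact h
  | succ j ih =>
    have := cc_one_le ih.le (j + 1)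
    simp only [bb]
    positivity

theorem ode_Bd {A1 : ℝ} {Φ x : ℝ → ℝ} (hs : UniqueDiffOn ℝ s) (hS : UniqueDiffOn ℝ S)
    (hL : 0 < L) (hA1 : 0 < A1) (hΦ : Bd S L k A1 Φ) (hx : MapsTo x s S)
    (hd : ∀ y ∈ s, HasDerivWithinAt x (Φ (x y)) s y) : 
    Bd s L k (bb A1 k) (derivWithin x s) := by
  have hc : ContinuousOn x s := fun y hy => (hd y hy).continuousWithinAt
  have he : EqOn (derivWithin x s) (fun y => Φ (x y)) s := fun y hy =>
    (hd y hy).derivWithin (hs y hy)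
  induction k with
  | zero =>
    rw [Bd_zero] at hΦ
    refine Bd.congr (Bd_zero.2 ⟨hΦ.1.comp hc hx, fun y hy => hΦ.2 _ (hx hy)⟩) he
  | succ k ih =>
    have h1 := ih (hΦ.mono_k (Nat.le_succ k))
    refine Bd.congr ?_ he
    refine hΦ.comp hs hS hL hL hA1.le (bb_pos hA1 k).le hx hc ?_
    rintro j hj
    obtain rfl : k = j := by omega
    refine ⟨fun y hy => (hd y hy).differentiableWithinAt, ?_⟩
    rwa [mul_div_cancel_right₀ _ hL.ne']

theorem J_lower {a b γ c : ℝ} {w : ℝ → ℝ} (hγ : γ ∈ Icc a b) (m : ℕ)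
    (hw : ContinuousOn w (Icc a b)) (h : ∀ x ∈ Icc a b, c ≤ w x) {x : ℝ} (hx : x ∈ Icc a b) :
    c / (m + 1) ≤ J γ m w x := by
  have e : c / (m + 1) = ∫ t in (0 : ℝ)..1, t ^ m * c := by
    rw [intervalIntegral.integral_mul_const, integral_pow]
    simp; ring
  rw [e, J]
  refine intervalIntegral.integral_mono_on zero_le_one
    (Continuous.intervalIntegrable (by fun_prop) _ _)
    (ContinuousOn.intervalIntegrable ?_) fun t ht => ?_
  · rw [uIcc_of_le zero_le_one]
    refine (continuousOn_pow m).mul (hw.comp (by fun_prop) fun t ht => seg_mem hγ hx ht)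
  · exact mul_le_mul_of_nonneg_left (h _ (seg_mem hγ hx ht)) (pow_nonneg ht.1 _)

theorem J_upper {a b γ c : ℝ} {w : ℝ → ℝ} (hγ : γ ∈ Icc a b) (m : ℕ)
    (hw : ContinuousOn w (Icc a b)) (h : ∀ x ∈ Icc a b, w x ≤ c) {x : ℝ} (hx : x ∈ Icc a b) :
    J γ m w x ≤ c / (m + 1) := by
  have := J_lower (w := fun x => - w x) (c := -c) hγ m hw.neg (fun x hx => neg_le_neg (h x hx)) hx
  have e : J γ m (fun x => - w x) x = - J γ m w x := by
    simp [J]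
  rw [e, neg_div] at this
  linarith

theorem J_base {γ : ℝ} {w : ℝ → ℝ} (m : ℕ) : J γ m w γ = w γ / (m + 1) := by
  simp [J, intervalIntegral.integral_mul_const, integral_pow]
  ring

/-- Structure of the phase. -/
theorem phase {α β γ lam m0 : ℝ} {f : ℝ → ℝ} (hα : α < γ) (hβ : γ < β) (hm0 : 0 < m0)
    (hf : ContDiffOn ℝ 3 f (Icc α β)) (hf1 : derivWithin f (Icc α β) γ = 0)
    (hlow : ∀ x ∈ Icc α β, m0 ≤ derivWithin (derivWithin f (Icc α β)) (Icc α β) x)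
    (hlam : 0 < lam) {p Q : ℝ → ℝ}
    (hp : p = J γ 0 (derivWithin (derivWithin f (Icc α β)) (Icc α β)))
    (hQ : Q = J γ 1 p) :
    (∀ x ∈ Icc α β, 0 < p x) ∧ (∀ x ∈ Icc α β, 0 < Q x) ∧
    (∀ x ∈ Icc α β, f x = f γ + (x - γ) ^ 2 * Q x) ∧
    (∀ x ∈ Icc α β, HasDerivWithinAt (fun x => (x - γ) * √(lam * Q x) / lam)
      (p x / (2 * √(lam * Q x))) (Icc α β) x) := by
  have hab : α < β := hα.trans hβ
  have hγ : γ ∈ Icc α β := ⟨hα.le, hβ.le⟩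
  have hs := uniqueDiffOn_Icc hab
  set I := Icc α β with hI
  rw [show (3 : WithTop ℕ∞) = 1 + 1 + 1 by norm_num, contDiffOn_succ_iff_derivWithin hs,
    contDiffOn_succ_iff_derivWithin hs] at hf
  obtain ⟨d0, -, d1, -, c2⟩ := hf
  have c2' := c2
  rw [show (1 : WithTop ℕ∞) = 0 + 1 by norm_num, contDiffOn_succ_iff_derivWithin hs] at c2'
  obtain ⟨d2, -, c3⟩ := c2'
  have hpd : ∀ x ∈ I, HasDerivWithinAt p
      (J γ 1 (derivWithin (derivWithin (derivWithin f I) I) I) x) I x := by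
    intro x hx
    rw [hp]
    exact J_deriv hab hγ 0 d2 c3.continuousOn hx
  have hpc : ContinuousOn p I := fun x hx => (hpd x hx).continuousWithinAt
  have hpdc : ContinuousOn (derivWithin p I) I :=
    (J_cont hab hγ 1 c3.continuousOn).congr fun x hx => (hpd x hx).derivWithin (hs x hx)
  have hpm : ∀ x ∈ I, m0 ≤ p x := by
    intro x hx
    have := J_lower hγ 0 c2.continuousOn hlow hx
    rw [hp]
    simpa using this
  have hQm : ∀ x ∈ I, 0 < Q x := by
    intro x hx
    have := J_lower hγ 1 hpc hpm hx
    rw [hQ]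
    refine lt_of_lt_of_le ?_ this
    positivity
  have f1 : ∀ x ∈ I, derivWithin f I x = (x - γ) * p x := by
    intro x hx
    have := J_ftc hab hγ d1 c2.continuousOn hx
    rw [hf1, sub_zero] at this
    rw [this, hp]
  have f0 : ∀ x ∈ I, f x = f γ + (x - γ) ^ 2 * Q x := by
    intro x hx
    have h1 := J_ftc hab hγ d0 d1.continuousOn hx
    have h2 : J γ 0 (derivWithin f I) x = (x - γ) * Q x := by
      rw [hQ, J, J, ← intervalIntegral.integral_const_mul]
      refine intervalIntegral.integral_congr fun t ht => ?_
      rw [uIcc_of_le zero_le_one] at ht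
      rw [f1 _ (seg_mem hγ hx ht)]
      ring
    rw [h2] at h1
    linear_combination h1
  have hQd : ∀ x ∈ I, HasDerivWithinAt Q (derivWithin Q I x) I x := by
    intro x hx
    have : HasDerivWithinAt Q (J γ 2 (derivWithin p I) x) I x := by
      rw [hQ]
      exact J_deriv hab hγ 1 (fun x hx => (hpd x hx).differentiableWithinAt) hpdc hx
    exact this.differentiableWithinAt.hasDerivWithinAt
  have hrel : ∀ x ∈ I, p x = 2 * Q x + (x - γ) * derivWithin Q I x := by
    intro x hx
    rcases eq_or_ne x γ with rfl | hne
    · rw [hQ, J_base]; push_cast; ring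
    · have h1 : HasDerivWithinAt (fun x => f γ + (x - γ) ^ 2 * Q x)
          (2 * (x - γ) * Q x + (x - γ) ^ 2 * derivWithin Q I x) I x := by
        have h2 : HasDerivWithinAt (fun x => (x - γ) ^ 2) (2 * (x - γ)) I x := by
          have := (((hasDerivAt_id x).sub_const γ).fun_pow 2).hasDerivWithinAt (s := I)
          refine HasDerivWithinAt.congr_deriv this ?_
          simp
        exact (h2.fun_mul (hQd x hx)).const_add _
      have h2 := (h1.congr f0 (f0 x hx)).derivWithin (hs x hx)
      rw [f1 x hx] at h2
      have : x - γ ≠ 0 := sub_ne_zero.2 hne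
      apply mul_left_cancel₀ this
      linear_combination h2
  refine ⟨fun x hx => hm0.trans_le (hpm x hx), hQm, f0, fun x hx => ?_⟩
  have hpos : 0 < lam * Q x := mul_pos hlam (hQm x hx)
  have h1 := ((hQd x hx).const_mul lam).sqrt hpos.ne'
  have h2 : HasDerivWithinAt (fun x => x - γ) 1 I x :=
    ((hasDerivAt_id x).sub_const γ).hasDerivWithinAt
  have h3 := (h2.fun_mul h1).div_const lam
  refine h3.congr_deriv ?_
  rw [hrel x hx]
  have hS := Real.sq_sqrt hpos.le
  have hSp := Real.sqrt_pos.2 hpos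
  set R := √(lam * Q x)
  field_simp
  linear_combination 2 * hS

theorem G_Bd (n : ℕ) (C : ℕ → ℝ) (hC : ∀ k, 0 < C k) :
    ∃ K : ℝ, 0 < K ∧
      ∀ (α β γ M N T U r1 r2 : ℝ) (f g xof : ℝ → ℝ),
        α < γ → γ < β → 0 < M → 0 < N → 0 < T → 0 < U →
        ContDiffOn ℝ (2 * n + 3) f (Set.Icc α β) →
        ContDiffOn ℝ (2 * n + 1) g (Set.Icc α β) →
        derivWithin f (Set.Icc α β) γ = 0 →
        (∀ r, 2 ≤ r → r ≤ 2 * n + 3 → ∀ x ∈ Set.Icc α β,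
          |iteratedDerivWithin r f (Set.Icc α β) x| ≤ C r * T / M ^ r) →
        (∀ x ∈ Set.Icc α β,
          T / (C 2 * M ^ 2) ≤ iteratedDerivWithin 2 f (Set.Icc α β) x) →
        (∀ s, s ≤ 2 * n + 1 → ∀ x ∈ Set.Icc α β,
          |iteratedDerivWithin s g (Set.Icc α β) x| ≤ C s * U / N ^ s) →
        ∀ lam2 : ℝ, lam2 = iteratedDerivWithin 2 f (Set.Icc α β) γ / 2 → 
        0 < r1 → 0 < r2 →
        xof 0 = γ →
        (∀ y ∈ Set.Icc (-r1) r2, xof y ∈ Set.Icc α β ∧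
          f (xof y) = f γ + lam2 * y ^ 2 ∧
          (y < 0 → xof y < γ) ∧ (0 < y → γ < xof y)) →
        Bd (Icc (-r1) r2) (min M N) (2 * n + 1) (K * U)
          (fun y => g (xof y) * derivWithin xof (Set.Icc (-r1) r2) y) := by
  set A0 : ℝ := ∑ j ∈ Finset.range (2 * n + 4), C j with hA0
  have hA0C : ∀ j ≤ 2 * n + 3, C j ≤ A0 := fun j hj =>
    Finset.single_le_sum (f := C) (fun i _ => (hC i).le) (Finset.mem_range.2 (by omega))
  have hA0p : 0 < A0 := (hC 0).trans_le (hA0C 0 (by omega))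
  have hc2 := hC 2
  obtain ⟨A1, hA1, hphi⟩ := phi_const (2 * n + 1) (C 2) A0 (hC 2) hA0p
  set B1 := bb A1 (2 * n + 1) with hB1
  have hB1p : 0 < B1 := bb_pos hA1 _
  have hccp := cc_one_le hB1p.le (2 * n + 1)
  refine ⟨2 ^ (2 * n + 1) * (cc B1 (2 * n + 1) * A0 * B1), by positivity, ?_⟩
  intro α β γ M N T U r1 r2 f g x hα hβ hM hN hT hU hf hg hf1 hfb hlow hgb lam hlam hr1 hr2 hx0 hx
  have hab : α < β := hα.trans hβ
  have hγ : γ ∈ Icc α β := ⟨hα.le, hβ.le⟩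
  have hS := uniqueDiffOn_Icc hab
  have hs : UniqueDiffOn ℝ (Icc (-r1) r2) := uniqueDiffOn_Icc (by linarith)
  have e2 : iteratedDerivWithin 2 f (Icc α β) =
      derivWithin (derivWithin f (Icc α β)) (Icc α β) := by
    rw [iteratedDerivWithin_succ', iteratedDerivWithin_succ', iteratedDerivWithin_zero]
  set L := min M N with hL
  have hLp : 0 < L := lt_min hM hN
  set w := derivWithin (derivWithin f (Icc α β)) (Icc α β) with hw
  -- bounds for the second derivative
  have hwB : Bd (Icc α β) L (2 * n + 1) (A0 * (T / M ^ 2)) w := by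
    refine Bd.mono_L hLp (by positivity) (L := M) ⟨?_, ?_⟩ (min_le_left _ _)
    · have h := hf
      rw [show (2 * n + 3 : WithTop ℕ∞) = ((2 * n + 1 : ℕ) : WithTop ℕ∞) + 1 + 1 by
        push_cast; rw [add_assoc, add_assoc]; norm_num, contDiffOn_succ_iff_derivWithin hS,
        contDiffOn_succ_iff_derivWithin hS] at h
      exact h.2.2.2.2
    · intro j hj z hz
      have := hfb (j + 2) (by omega) (by omega) z hz
      rw [iteratedDerivWithin_succ', iteratedDerivWithin_succ'] at this
      refine this.trans ?_
      have e : A0 * (T / M ^ 2) / M ^ j = A0 * T / M ^ (j + 2) := by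
        field_simp; ring
      rw [e]
      gcongr
      exact hA0C _ (by omega)
  have hwc := hwB.1.continuousOn
  have hlow' : ∀ z ∈ Icc α β, T / (C 2 * M ^ 2) ≤ w z := by
    intro z hz; rw [← e2]; exact hlow z hz
  have hup' : ∀ z ∈ Icc α β, w z ≤ C 2 * T / M ^ 2 := by
    intro z hz; rw [← e2]; exact (le_abs_self _).trans (hfb 2 le_rfl (by omega) z hz)
  rw [e2] at hlam
  have hlaml : T / (C 2 * M ^ 2) / 2 ≤ lam := by
    rw [hlam]; have := hlow' γ hγ; linarith
  have hlamu : lam ≤ C 2 * T / M ^ 2 / 2 := by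
    rw [hlam]; have := hup' γ hγ; linarith
  have hm0 : 0 < T / (C 2 * M ^ 2) := by positivity
  have hlamp : 0 < lam := by linarith
  obtain ⟨p, hp⟩ : ∃ p, p = J γ 0 w := ⟨_, rfl⟩
  obtain ⟨Q, hQ⟩ : ∃ Q, Q = J γ 1 p := ⟨_, rfl⟩
  obtain ⟨hpp, hQp, hfQ, hder⟩ := phase hα hβ hm0
    (hf.of_le (by exact_mod_cast (by omega : 3 ≤ 2 * n + 3))) hf1 hlow' hlamp hp hQ
  have hpB : Bd (Icc α β) L (2 * n + 1) (A0 * (T / M ^ 2)) p := hp ▸ J_Bd hab hγ 0 hwB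
  have hQB : Bd (Icc α β) L (2 * n + 1) (A0 * (T / M ^ 2)) Q := hQ ▸ J_Bd hab hγ 1 hpB
  have hpl : ∀ z ∈ Icc α β, T / (C 2 * M ^ 2) ≤ p z := by
    intro z hz
    have := J_lower hγ 0 hwc hlow' hz
    rw [hp]; simpa using this
  have hpu : ∀ z ∈ Icc α β, p z ≤ C 2 * T / M ^ 2 := by
    intro z hz
    have := J_upper hγ 0 hwc hup' hz
    rw [hp]; simpa using this
  have hQl : ∀ z ∈ Icc α β, T / (C 2 * M ^ 2) / 2 ≤ Q z := by
    intro z hz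
    have := J_lower hγ 1 hpB.1.continuousOn hpl hz
    norm_num at this
    rw [hQ]; exact this
  have hQu : ∀ z ∈ Icc α β, Q z ≤ C 2 * T / M ^ 2 / 2 := by
    intro z hz
    have := J_upper hγ 1 hpB.1.continuousOn hpu hz
    norm_num at this
    rw [hQ]; exact this
  -- normalised functions
  set μ : ℝ := M ^ 2 / T with hμ
  have hμp : 0 < μ := by positivity
  have m1 : μ * (T / (C 2 * M ^ 2)) = 1 / C 2 := by rw [hμ]; field_simp
  have m2 : μ * (C 2 * T / M ^ 2) = C 2 := by rw [hμ]; field_simp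
  have hΦ := hphi (Icc α β) L (fun z => μ * p z) (fun z => (μ * lam * μ) * Q z) hS hLp
    (by
      have := hpB.const_mul hS μ
      rw [abs_of_pos hμp] at this
      refine this.mono hLp (le_of_eq ?_)
      rw [hμ]; field_simp)
    (by
      have := hQB.const_mul hS (μ * lam * μ)
      rw [abs_of_pos (by positivity)] at this
      refine this.mono hLp ?_
      have e : μ * lam * μ * (A0 * (T / M ^ 2)) = (μ * lam) * A0 := by
        rw [hμ]; field_simp
      rw [e]
      gcongr
      calc μ * lam ≤ μ * (C 2 * T / M ^ 2 / 2) := by gcongr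
        _ = μ * (C 2 * T / M ^ 2) / 2 := by ring
        _ = C 2 / 2 := by rw [m2]
        _ ≤ C 2 := by linarith)
    (by
      intro z hz
      constructor
      · rw [← m1]; exact mul_le_mul_of_nonneg_left (hpl z hz) hμp.le
      · have : μ * p z ≤ C 2 := by
          rw [← m2]; exact mul_le_mul_of_nonneg_left (hpu z hz) hμp.le
        have : 0 < 1 / C 2 := by positivity
        linarith)
    (by
      intro z hz
      have a1 : 1 / C 2 / 2 ≤ μ * lam := by
        rw [← m1, mul_div_assoc]; gcongr
      have a2 : μ * lam ≤ C 2 / 2 := by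
        rw [← m2, mul_div_assoc]; gcongr
      have b1 : 1 / C 2 / 2 ≤ μ * Q z := by
        rw [← m1, mul_div_assoc]; have := hQl z hz; gcongr
      have b2 : μ * Q z ≤ C 2 / 2 := by
        rw [← m2, mul_div_assoc]; have := hQu z hz; gcongr
      have hq := hQp z hz
      have e : μ * lam * μ * Q z = (μ * lam) * (μ * Q z) := by ring
      simp only [e]
      constructor
      · calc 1 / (4 * C 2 ^ 2) = (1 / C 2 / 2) * (1 / C 2 / 2) := by field_simp; norm_num
          _ ≤ _ := by gcongr
      · calc (μ * lam) * (μ * Q z) ≤ (C 2 / 2) * (C 2 / 2) := by gcongr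
          _ ≤ C 2 ^ 2 := by nlinarith
          _ ≤ _ := by
            have : 0 < 1 / (4 * C 2 ^ 2) := by positivity
            linarith)
  set Φ : ℝ → ℝ := fun z => √(μ * lam * μ * Q z) * (2 * (μ * p z)⁻¹) with hΦd
  have hΦe : ∀ z ∈ Icc α β, (p z / (2 * √(lam * Q z)))⁻¹ = Φ z := by
    intro z hz
    have h1 := hpp z hz
    have e : μ * lam * μ * Q z = μ ^ 2 * (lam * Q z) := by ring
    simp only [hΦd, e]
    rw [Real.sqrt_mul (sq_nonneg μ), Real.sqrt_sq hμp.le]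
    field_simp
  have hDpos : ∀ z ∈ Icc α β, 0 < p z / (2 * √(lam * Q z)) := by
    intro z hz
    have h1 := hpp z hz
    have h2 := Real.sqrt_pos.2 (mul_pos hlamp (hQp z hz))
    positivity
  have hmaps : MapsTo x (Icc (-r1) r2) (Icc α β) := fun y hy => (hx y hy).1
  obtain ⟨hxc, hxd⟩ := inv_deriv (c := A1⁻¹) (x := x) (s := Icc (-r1) r2) (by positivity) hder (by
      intro z hz
      have h1 := hDpos z hz
      have h2 := hΦ.abs_le hz
      rw [← hΦe z hz, abs_of_pos (by positivity)] at h2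
      exact inv_le_of_inv_le₀ h1 h2) hmaps (by
      intro y hy
      obtain ⟨hy1, hy2, hy3, hy4⟩ := hx y hy
      have hq := hQp _ hy1
      have hsq := Real.sq_sqrt (mul_pos hlamp hq).le
      have hsp := Real.sqrt_pos.2 (mul_pos hlamp hq)
      rw [hfQ _ hy1] at hy2
      have h2 : ((x y - γ) * √(lam * Q (x y)) / lam) ^ 2 = y ^ 2 := by
        rw [div_pow, mul_pow, hsq]
        field_simp
        linear_combination hy2
      rcases lt_trichotomy y 0 with h | h | h
      · have h3 := hy3 h
        have h4 : (x y - γ) * √(lam * Q (x y)) / lam < 0 :=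
          div_neg_of_neg_of_pos (mul_neg_of_neg_of_pos (by linarith) hsp) hlamp
        rcases sq_eq_sq_iff_eq_or_eq_neg.1 h2 with h5 | h5
        · exact h5
        · linarith
      · subst h; simp [hx0]
      · have h3 := hy4 h
        have h4 : 0 < (x y - γ) * √(lam * Q (x y)) / lam :=
          div_pos (mul_pos (by linarith) hsp) hlamp
        rcases sq_eq_sq_iff_eq_or_eq_neg.1 h2 with h5 | h5
        · exact h5
        · linarith)
  have hxd' : ∀ y ∈ Icc (-r1) r2, HasDerivWithinAt x (Φ (x y)) (Icc (-r1) r2) y := by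
    intro y hy
    rw [← hΦe _ (hmaps hy)]
    exact hxd y hy
  have hxB := ode_Bd hs hS hLp hA1 hΦ hmaps hxd'
  have hgB : Bd (Icc α β) L (2 * n + 1) (A0 * U) g := by
    refine Bd.mono_L hLp (by positivity) (L := N) ⟨by exact_mod_cast hg, ?_⟩ (min_le_right _ _)
    intro j hj z hz
    refine (hgb j hj z hz).trans ?_
    gcongr
    exact hA0C _ (by omega)
  have hgx := hgB.comp (B := B1) hs hS hLp hLp (by positivity) hB1p.le hmaps hxc (by
    intro j hj
    refine ⟨fun y hy => (hxd' y hy).differentiableWithinAt, ?_⟩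
    rw [mul_div_cancel_right₀ _ hLp.ne']
    exact hxB.mono_k (by omega))
  refine (hgx.mul hs hLp (by positivity) hB1p.le hxB).mono hLp (le_of_eq ?_)
  ring

theorem iter_add (i k : ℕ) (φ : ℝ → ℝ) (s : Set ℝ) :
    iteratedDerivWithin k (iteratedDerivWithin i φ s) s = iteratedDerivWithin (k + i) φ s := by
  induction i generalizing φ with
  | zero => simp
  | succ i ih => rw [iteratedDerivWithin_succ', ih, ← add_assoc, iteratedDerivWithin_succ']

theorem contDiffOn_iter (hs : UniqueDiffOn ℝ s) (i k : ℕ) (h : ContDiffOn ℝ (k + i : ℕ) φ s) :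
    ContDiffOn ℝ k (iteratedDerivWithin i φ s) s := by
  induction i generalizing φ with
  | zero => simpa using h
  | succ i ih =>
    rw [iteratedDerivWithin_succ']
    apply ih
    rw [← add_assoc] at h
    push_cast at h
    rw [contDiffOn_succ_iff_derivWithin hs] at h
    exact_mod_cast h.2.2

end WSP

/-- Lemma 2.4 of the paper: under the phase and weight setup, with
`G(y) = g(x(y))·x'(y)` and `ϖ_k = G^{(k)}(0)/k!`, for every `1 ≤ i ≤ n+2` and
`|y| ≤ min(r₁, r₂, ΔM)`,
`G^{(i)}(y) = Σ_{k=0}^{2n−i} ((k+i)!/k!) ϖ_{k+i} y^k + O(U|y|^{2n+1−i}(1/M^{2n+1} + 1/N^{2n+1}))`,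
with implied constant depending only on `n` and `C₀,…,C_{2n+3}`. -/
theorem weighted_stationary_phase_stmt13
    (n : ℕ) (hn : 2 ≤ n) (C : ℕ → ℝ) (hC : ∀ k, 0 < C k) :
    ∃ K : ℝ, 0 < K ∧
      ∀ (α β γ M N T U r1 r2 : ℝ) (f g xof : ℝ → ℝ),
        α < γ → γ < β → 0 < M → 0 < N → 0 < T → 0 < U → β - α ≤ M →
        ContDiffOn ℝ (2 * n + 3) f (Set.Icc α β) →
        ContDiffOn ℝ (2 * n + 1) g (Set.Icc α β) →
        derivWithin f (Set.Icc α β) γ = 0 →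
        (∀ r, 2 ≤ r → r ≤ 2 * n + 3 → ∀ x ∈ Set.Icc α β,
          |iteratedDerivWithin r f (Set.Icc α β) x| ≤ C r * T / M ^ r) →
        (∀ x ∈ Set.Icc α β,
          T / (C 2 * M ^ 2) ≤ iteratedDerivWithin 2 f (Set.Icc α β) x) →
        (∀ s, s ≤ 2 * n + 1 → ∀ x ∈ Set.Icc α β,
          |iteratedDerivWithin s g (Set.Icc α β) x| ≤ C s * U / N ^ s) →
        let lam2 : ℝ := iteratedDerivWithin 2 f (Set.Icc α β) γ / 2
        let Δ : ℝ := min (Real.log 2 / C 2)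
          (1 / ((C 2) ^ 2 *
            (Finset.Icc 2 (2 * n + 3)).sup' (Finset.nonempty_Icc.mpr (by omega)) C))
        0 < r1 → 0 < r2 →
        f α = f γ + lam2 * r1 ^ 2 →
        f β = f γ + lam2 * r2 ^ 2 →
        xof 0 = γ →
        (∀ y ∈ Set.Icc (-r1) r2, xof y ∈ Set.Icc α β ∧
          f (xof y) = f γ + lam2 * y ^ 2 ∧
          (y < 0 → xof y < γ) ∧ (0 < y → γ < xof y)) →
        let G : ℝ → ℝ := fun y => g (xof y) * derivWithin xof (Set.Icc (-r1) r2) y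
        let ϖ : ℕ → ℝ := fun k =>
          iteratedDerivWithin k G (Set.Icc (-r1) r2) 0 / (Nat.factorial k : ℝ)
        ∀ i, 1 ≤ i → i ≤ n + 2 →
          ∀ y : ℝ, |y| ≤ min r1 (min r2 (Δ * M)) →
            |iteratedDerivWithin i G (Set.Icc (-r1) r2) y -
                ∑ k ∈ Finset.range (2 * n - i + 1),
                  ((Nat.factorial (k + i) : ℝ) / (Nat.factorial k : ℝ)) * ϖ (k + i) * y ^ k| ≤
              K * (U * |y| ^ (2 * n + 1 - i) * (1 / M ^ (2 * n + 1) + 1 / N ^ (2 * n + 1))) := by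
  obtain ⟨K, hK, h⟩ := WSP.G_Bd n C hC
  refine ⟨K, hK, ?_⟩
  intro α β γ M N T U r1 r2 f g xof hα hβ hM hN hT hU _ hf hg hf1 hfb hlow hgb lam2 Δ hr1 hr2 _ _
    hx0 hx G ϖ i hi1 hi2 y hy
  have hB := h α β γ M N T U r1 r2 f g xof hα hβ hM hN hT hU hf hg hf1 hfb hlow hgb lam2 rfl
    hr1 hr2 hx0 hx
  have hy1 : |y| ≤ r1 := hy.trans (min_le_left _ _)
  have hy2 : |y| ≤ r2 := hy.trans ((min_le_right _ _).trans (min_le_left _ _))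
  have hyI : y ∈ Set.Icc (-r1) r2 := ⟨(abs_le.1 hy1).1, (abs_le.1 hy2).2⟩
  have hab : -r1 < r2 := by linarith
  have hsplit : 2 * n + 1 = (2 * n + 1 - i) + i := by omega
  have hcd : ContDiffOn ℝ ((2 * n + 1 - i + i : ℕ) : WithTop ℕ∞) G (Set.Icc (-r1) r2) := by
    rw [← hsplit]; exact hB.1
  have key := WSP.taylor_bd hab ⟨by linarith, hr2.le⟩ (2 * n + 1 - i)
    (φ := iteratedDerivWithin i G (Set.Icc (-r1) r2))
    (E := K * U / (min M N) ^ (2 * n + 1))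
    (WSP.contDiffOn_iter (uniqueDiffOn_Icc hab) i _ hcd) (by
      intro z hz
      rw [WSP.iter_add, ← hsplit]
      exact hB.2 _ le_rfl z hz) y hyI
  have hr : 2 * n - i + 1 = 2 * n + 1 - i := by omega
  have hsum : ∑ k ∈ Finset.range (2 * n - i + 1),
      ((Nat.factorial (k + i) : ℝ) / (Nat.factorial k : ℝ)) * ϖ (k + i) * y ^ k =
      ∑ k ∈ Finset.range (2 * n + 1 - i),
        iteratedDerivWithin k (iteratedDerivWithin i G (Set.Icc (-r1) r2)) (Set.Icc (-r1) r2) 0 /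
          (k.factorial : ℝ) * y ^ k := by
    rw [hr]
    refine Finset.sum_congr rfl fun k _ => ?_
    rw [WSP.iter_add]
    simp only [ϖ]
    have : ((k + i).factorial : ℝ) ≠ 0 := by positivity
    field_simp
  rw [hsum]
  refine key.trans ?_
  have hmin : 1 / (min M N) ^ (2 * n + 1) ≤ 1 / M ^ (2 * n + 1) + 1 / N ^ (2 * n + 1) := by
    have h1 : 0 < 1 / M ^ (2 * n + 1) := by positivity
    have h2 : 0 < 1 / N ^ (2 * n + 1) := by positivity
    rcases min_choice M N with h | h <;> rw [h] <;> linarith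
  calc K * U / (min M N) ^ (2 * n + 1) * |y| ^ (2 * n + 1 - i)
      = K * (U * |y| ^ (2 * n + 1 - i) * (1 / (min M N) ^ (2 * n + 1))) := by ring
    _ ≤ _ := by gcongr
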